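/- arXiv:2307.01951 — 4 statements merged into one kernel-verified Lean document; each statement's English description precedes it below -/
import Mathlib

section
/- (Theorem 4.1.) With T_B, T_W, Σ_B(X), Σ_W(X) defined as in the context, the following sandwich bounds hold, all sums running over i = 1,…,d: (Σ_i λ_{−i}(Σ_B)·λ_i(T_B)) / (Σ_i λ_i(Σ_B)) ≤ Tr(Σ_B(X))/Tr(Σ_B) ≤ (Σ_i λ_i(Σ_B)·λ_i(T_B)) / (Σ_i λ_i(Σ_B)), and (Σ_i λ_{−i}(Σ_W)·λ_i(T_W)) / (Σ_i λ_i(Σ_W)) ≤ Tr(Σ_W(X))/Tr(Σ_W) ≤ (Σ_i λ_i(Σ_W)·λ_i(T_W)) / (Σ_i λ_i(Σ_W)). -/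
open Matrix Finset

noncomputable section

namespace Matrix

variable {m : Type*} [Fintype m] [DecidableEq m]

/-- The entrywise square of an orthogonal matrix is doubly stochastic. -/
theorem sq_entries_mem_doublyStochastic {O : Matrix m m ℝ}
    (hO : O ∈ orthogonalGroup m ℝ) :
    of (fun i j => O i j ^ 2) ∈ doublyStochastic ℝ m := by
  rw [mem_doublyStochastic_iff_sum]
  refine ⟨fun i j => sq_nonneg _, fun i => ?_, fun j => ?_⟩
  · have h := congrFun (congrFun ((mem_orthogonalGroup_iff m ℝ).1 hO) i) i
    simpa [mul_apply, star_apply, sq] using h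
  · have h := congrFun (congrFun ((mem_orthogonalGroup_iff' m ℝ).1 hO) j) j
    simpa [mul_apply, star_apply, sq] using h

/-- The trace of a product of two real symmetric matrices is a convex combination of the
pairings of their eigenvalues. -/
theorem IsHermitian.exists_trace_mul_eq_sum_perm {A B : Matrix m m ℝ}
    (hA : A.IsHermitian) (hB : B.IsHermitian) :
    ∃ w : Equiv.Perm m → ℝ, (∀ σ, 0 ≤ w σ) ∧ ∑ σ, w σ = 1 ∧
      (A * B).trace = ∑ σ, w σ * ∑ i, hA.eigenvalues i * hB.eigenvalues (σ i) := by
  set O := star hA.eigenvectorUnitary * hB.eigenvectorUnitary with hO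
  obtain ⟨w, hw, hw1, hwO⟩ :=
    exists_eq_sum_perm_of_mem_doublyStochastic (sq_entries_mem_doublyStochastic O.2)
  refine ⟨w, hw, hw1, ?_⟩
  have htrace : (A * B).trace = ∑ i, hA.eigenvalues i *
      (of (fun i j => (O : Matrix m m ℝ) i j ^ 2) *ᵥ hB.eigenvalues) i := by
    conv_lhs => rw [hA.spectral_theorem, hB.spectral_theorem, Unitary.conjStarAlgAut_apply,
      Unitary.conjStarAlgAut_apply]
    have : (O : Matrix m m ℝ) =
      star (hA.eigenvectorUnitary : Matrix m m ℝ) * (hB.eigenvectorUnitary : Matrix m m ℝ) := rfl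
    trans (diagonal hA.eigenvalues * ((O : Matrix m m ℝ) * diagonal hB.eigenvalues *
      star (O : Matrix m m ℝ))).trace
    · rw [this, star_mul, star_star, mul_assoc, mul_assoc, trace_mul_comm]
      simp only [mul_assoc]
      rfl
    · refine sum_congr rfl fun i _ => ?_
      rw [diag_apply, diagonal_mul, mul_apply]
      simp only [mul_diagonal, star_apply, star_trivial, mulVec, dotProduct, of_apply]
      congr 1
      exact sum_congr rfl fun j _ => by ring
  rw [htrace, ← hwO]
  simp only [sum_mulVec, smul_mulVec, permMatrix_mulVec, Finset.sum_apply, Pi.smul_apply,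
    smul_eq_mul, Function.comp_apply, mul_sum]
  rw [sum_comm]
  exact sum_congr rfl fun σ _ => sum_congr rfl fun i _ => by ring

/-- Von Neumann's trace inequality, with both bounds, for real symmetric matrices whose
eigenvalues are enumerated in decreasing order by `μ` and `τ`. -/
theorem IsHermitian.sum_rev_mul_le_trace_mul_le_sum_mul {d : ℕ} {A B : Matrix (Fin d) (Fin d) ℝ}
    (hA : A.IsHermitian) (hB : B.IsHermitian) {μ τ : Fin d → ℝ}
    (hμ : Antitone μ) (hμA : ∃ σ : Equiv.Perm (Fin d), μ = hA.eigenvalues ∘ σ)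
    (hτ : Antitone τ) (hτB : ∃ σ : Equiv.Perm (Fin d), τ = hB.eigenvalues ∘ σ) :
    ∑ i, μ i.rev * τ i ≤ (A * B).trace ∧ (A * B).trace ≤ ∑ i, μ i * τ i := by
  obtain ⟨ρ, hρ⟩ := hμA
  obtain ⟨π, hπ⟩ := hτB
  obtain ⟨w, hw, hw1, htrace⟩ := hA.exists_trace_mul_eq_sum_perm hB
  have hpair (σ : Equiv.Perm (Fin d)) :
      ∑ i, hA.eigenvalues i * hB.eigenvalues (σ i) = ∑ i, μ i * τ ((ρ.trans σ).trans π.symm i) := by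
    rw [← Equiv.sum_comp ρ]
    simp [hρ, hπ]
  have hlower (σ : Equiv.Perm (Fin d)) :
      ∑ i, μ i.rev * τ i ≤ ∑ i, hA.eigenvalues i * hB.eigenvalues (σ i) := by
    have hanti : Antivary (fun i => μ (Fin.rev i)) τ :=
      Monotone.antivary (fun i j h => hμ (Fin.rev_le_rev.2 h)) hτ
    refine (hanti.sum_mul_le_sum_mul_comp_perm
      (σ := Fin.revPerm.trans ((ρ.trans σ).trans π.symm))).trans_eq ?_
    rw [hpair, ← Equiv.sum_comp Fin.revPerm]
    simp
  have hupper (σ : Equiv.Perm (Fin d)) :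
      ∑ i, hA.eigenvalues i * hB.eigenvalues (σ i) ≤ ∑ i, μ i * τ i :=
    (hpair σ).trans_le (hμ.monovary hτ).sum_mul_comp_perm_le_sum_mul
  rw [htrace, ← one_mul (∑ i, μ i.rev * τ i), ← one_mul (∑ i, μ i * τ i), ← hw1, sum_mul, sum_mul]
  exact ⟨sum_le_sum fun σ _ => mul_le_mul_of_nonneg_left (hlower σ) (hw σ),
    sum_le_sum fun σ _ => mul_le_mul_of_nonneg_left (hupper σ) (hw σ)⟩

/-- Von Neumann's trace inequality normalised by the trace of the first factor. -/
theorem PosSemidef.trace_mul_div_trace_bounds {d : ℕ} {A B : Matrix (Fin d) (Fin d) ℝ}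
    (hA : A.PosSemidef) (hB : B.IsHermitian) {μ τ : Fin d → ℝ}
    (hμ : Antitone μ) (hμA : ∃ σ : Equiv.Perm (Fin d), μ = hA.1.eigenvalues ∘ σ)
    (hτ : Antitone τ) (hτB : ∃ σ : Equiv.Perm (Fin d), τ = hB.eigenvalues ∘ σ) :
    (∑ i, μ i.rev * τ i) / (∑ i, μ i) ≤ (A * B).trace / A.trace ∧
      (A * B).trace / A.trace ≤ (∑ i, μ i * τ i) / (∑ i, μ i) := by
  have hsum : ∑ i, μ i = A.trace := by
    obtain ⟨ρ, rfl⟩ := hμA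
    rw [hA.1.trace_eq_sum_eigenvalues]
    exact Equiv.sum_comp ρ hA.1.eigenvalues
  obtain ⟨hl, hu⟩ := hA.1.sum_rev_mul_le_trace_mul_le_sum_mul hB hμ hμA hτ hτB
  rw [hsum]
  exact ⟨div_le_div_of_nonneg_right hl hA.trace_nonneg,
    div_le_div_of_nonneg_right hu hA.trace_nonneg⟩

/-- Cyclicity of the trace for a product `V S Wᵀ`. -/
theorem trace_mul_mul_transpose {k l : Type*} [Fintype k] [Fintype l]
    (V W : Matrix k l ℝ) (S : Matrix l l ℝ) :
    (V * S * Wᵀ).trace = (S * (Wᵀ * V)).trace := by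
  rw [Matrix.mul_assoc, trace_mul_comm, Matrix.mul_assoc]

end Matrix

/-- Theorem 4.1: sandwich bounds on the ratios of traces of the between- and within-class
covariance matrices after one graph-convolution layer, in terms of decreasingly ordered
eigenvalue lists `μB, τB, μW, τW` of `Σ_B, T_B, Σ_W, T_W` respectively; for a decreasing
list `μ`, the `i`-th largest eigenvalue is `μ i` and the `i`-th smallest is `μ i.rev`. -/
theorem layerwise_trace_ratio_bounds
    (d d' n : ℕ) (hn : 1 ≤ n) (p q : ℝ) (hp : 0 < p) (hq : 0 < q)
    (SB SW : Matrix (Fin d) (Fin d) ℝ)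
    (hSB : SB.PosSemidef) (hSW : SW.PosSemidef)
    (hSBtr : 0 < SB.trace) (hSWtr : 0 < SW.trace)
    (W1 W2 : Matrix (Fin d') (Fin d) ℝ)
    -- `T_B = (W₁ + β₁W₂)ᵀ(W₁ + β₁W₂)` with `β₁ = (p−q)/(p+q)`
    (TB : Matrix (Fin d) (Fin d) ℝ)
    (hTBdef : TB = (W1 + ((p - q) / (p + q)) • W2)ᵀ * (W1 + ((p - q) / (p + q)) • W2))
    -- `T_W = W₁ᵀW₁ + β₂(W₂ᵀW₁ + W₁ᵀW₂) + β₃W₂ᵀW₂` with `β₂ = p/(n(p+q))`,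
    -- `β₃ = (p²+q²)/(n(p+q)²)`
    (TW : Matrix (Fin d) (Fin d) ℝ)
    (hTWdef : TW = W1ᵀ * W1
      + (p / ((n : ℝ) * (p + q))) • (W2ᵀ * W1 + W1ᵀ * W2)
      + ((p ^ 2 + q ^ 2) / ((n : ℝ) * (p + q) ^ 2)) • (W2ᵀ * W2))
    (hTB : TB.IsHermitian) (hTW : TW.IsHermitian)
    -- decreasing enumerations of the eigenvalues of `Σ_B, T_B, Σ_W, T_W`
    (μB τB μW τW : Fin d → ℝ)
    (hμBmono : Antitone μB)
    (hμBperm : ∃ σ : Equiv.Perm (Fin d), μB = hSB.1.eigenvalues ∘ σ)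
    (hτBmono : Antitone τB)
    (hτBperm : ∃ σ : Equiv.Perm (Fin d), τB = hTB.eigenvalues ∘ σ)
    (hμWmono : Antitone μW)
    (hμWperm : ∃ σ : Equiv.Perm (Fin d), μW = hSW.1.eigenvalues ∘ σ)
    (hτWmono : Antitone τW)
    (hτWperm : ∃ σ : Equiv.Perm (Fin d), τW = hTW.eigenvalues ∘ σ) :
    -- between-class bounds, with `Σ_B(X) = (W₁+β₁W₂) Σ_B (W₁+β₁W₂)ᵀ`
    ((∑ i, μB i.rev * τB i) / (∑ i, μB i) ≤
        ((W1 + ((p - q) / (p + q)) • W2) * SB * (W1 + ((p - q) / (p + q)) • W2)ᵀ).trace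
          / SB.trace ∧
      ((W1 + ((p - q) / (p + q)) • W2) * SB * (W1 + ((p - q) / (p + q)) • W2)ᵀ).trace
          / SB.trace ≤ (∑ i, μB i * τB i) / (∑ i, μB i)) ∧
    -- within-class bounds, with
    -- `Σ_W(X) = W₁ Σ_W W₁ᵀ + β₂(W₁ Σ_W W₂ᵀ + W₂ Σ_W W₁ᵀ) + β₃ W₂ Σ_W W₂ᵀ`
    ((∑ i, μW i.rev * τW i) / (∑ i, μW i) ≤
        (W1 * SW * W1ᵀ
          + (p / ((n : ℝ) * (p + q))) • (W1 * SW * W2ᵀ + W2 * SW * W1ᵀ)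
          + ((p ^ 2 + q ^ 2) / ((n : ℝ) * (p + q) ^ 2)) • (W2 * SW * W2ᵀ)).trace
          / SW.trace ∧
      (W1 * SW * W1ᵀ
          + (p / ((n : ℝ) * (p + q))) • (W1 * SW * W2ᵀ + W2 * SW * W1ᵀ)
          + ((p ^ 2 + q ^ 2) / ((n : ℝ) * (p + q) ^ 2)) • (W2 * SW * W2ᵀ)).trace
          / SW.trace ≤ (∑ i, μW i * τW i) / (∑ i, μW i)) := by
  have hBtrace : ((W1 + ((p - q) / (p + q)) • W2) * SB *
      (W1 + ((p - q) / (p + q)) • W2)ᵀ).trace = (SB * TB).trace := by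
    rw [trace_mul_mul_transpose, hTBdef]
  have hWtrace : (W1 * SW * W1ᵀ
      + (p / ((n : ℝ) * (p + q))) • (W1 * SW * W2ᵀ + W2 * SW * W1ᵀ)
      + ((p ^ 2 + q ^ 2) / ((n : ℝ) * (p + q) ^ 2)) • (W2 * SW * W2ᵀ)).trace =
      (SW * TW).trace := by
    simp only [hTWdef, Matrix.mul_add, Matrix.mul_smul, trace_add, trace_smul,
      trace_mul_mul_transpose]
  rw [hBtrace, hWtrace]
  exact ⟨hSB.trace_mul_div_trace_bounds hTB hμBmono hμBperm hτBmono hτBperm,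
    hSW.trace_mul_div_trace_bounds hTW hμWmono hμWperm hτWmono hτWperm⟩

end
end

section
/- (Core necessity lemma, λ_Z = 0 case in the proof of Theorem 3.1.) Suppose Z̄ ∈ ℝ^{C×C} is invertible and (Z̄ ⊗ 1_n^T)·Â = I_C ⊗ 1_n^T. Then for every class c and every node index i ∈ {1,…,n}, the neighbor-fraction vector (s_{c1,i},…,s_{cC,i})ᵀ equals Z̄^{-1} e_c, where e_c is the c-th standard basis vector of ℝ^C; in particular this vector does not depend on i, so the graph G satisfies condition C. -/
open Matrix Finset

noncomputable section

/-- Nodes of the graph: class index in `Fin C`, within-class index in `Fin n`. -/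
abbrev Node (C n : ℕ) := Fin C × Fin n

/-- Degree of node `v` (row/column sum of the 0-1 adjacency matrix). -/
def deg {C n : ℕ} (A : Matrix (Node C n) (Node C n) ℝ) (v : Node C n) : ℝ :=
  ∑ u, A v u

/-- Normalized adjacency matrix `Â = A D⁻¹`. -/
def Ahat {C n : ℕ} (A : Matrix (Node C n) (Node C n) ℝ) :
    Matrix (Node C n) (Node C n) ℝ :=
  Matrix.of fun u v => A u v / deg A v

/-- `s_{cc',i}`: fraction of the neighbors of node `(c,i)` lying in class `c'`. -/
def sfrac {C n : ℕ} (A : Matrix (Node C n) (Node C n) ℝ) (c c' : Fin C) (i : Fin n) : ℝ :=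
  (∑ j, A (c', j) (c, i)) / deg A (c, i)

/-- Condition C: within each class all nodes have the same neighbor-fraction tuple. -/
def CondC {C n : ℕ} (A : Matrix (Node C n) (Node C n) ℝ) : Prop :=
  ∀ (c c' : Fin C) (i i' : Fin n), sfrac A c c' i = sfrac A c c' i'

/-- Target matrix `Y = I_C ⊗ 1ₙᵀ`. -/
def Ymat (C n : ℕ) : Matrix (Fin C) (Node C n) ℝ :=
  Matrix.of fun c v => if v.1 = c then 1 else 0

/-- Squared Frobenius norm. -/
def frobSq {m k : Type*} [Fintype m] [Fintype k] (M : Matrix m k ℝ) : ℝ :=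
  ∑ i, ∑ j, (M i j) ^ 2

/-- The gUFM risk. -/
def Risk {C n d : ℕ} (A : Matrix (Node C n) (Node C n) ℝ) (lamH lamW : ℝ)
    (W : Matrix (Fin C) (Fin d) ℝ) (H : Matrix (Fin d) (Node C n) ℝ) : ℝ :=
  (1 / (2 * ((C : ℝ) * (n : ℝ)))) * frobSq (W * H * Ahat A - Ymat C n)
    + (lamH / 2) * frobSq H + (lamW / 2) * frobSq W

/-- `H` is collapsed: within each class all columns coincide. -/
def Collapsed {C n d : ℕ} (H : Matrix (Fin d) (Node C n) ℝ) : Prop :=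
  ∀ (r : Fin d) (c : Fin C) (i i' : Fin n), H r (c, i) = H r (c, i')

/-- Multiplying `Z̄ ⊗ 1ₙᵀ` by `Â` applies `Z̄` to the neighbor-fraction vectors. -/
lemma kronecker_mul_Ahat_apply {C n : ℕ} (A : Matrix (Node C n) (Node C n) ℝ)
    (Zbar : Matrix (Fin C) (Fin C) ℝ) (k c : Fin C) (i : Fin n) :
    ((Matrix.of fun (c : Fin C) (v : Node C n) => Zbar c v.1) * Ahat A) k (c, i) =
      (Zbar *ᵥ fun c' => sfrac A c c' i) k := by
  simp only [Matrix.mul_apply, Matrix.mulVec, dotProduct, Matrix.of_apply, Ahat, sfrac,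
    Fintype.sum_prod_type, Finset.sum_div, Finset.mul_sum]

/-- Core necessity lemma (λ_Z = 0 case in the proof of Theorem 3.1): if `Z̄` is invertible
and `(Z̄ ⊗ 1ₙᵀ)·Â = I_C ⊗ 1ₙᵀ`, then each neighbor-fraction vector of a node `(c,i)`
equals `Z̄⁻¹ e_c`, independently of `i`; in particular the graph satisfies condition C. -/
theorem necessity_lamZ_zero
    (C n : ℕ) (hC : 2 ≤ C) (hn : 1 ≤ n)
    (A : Matrix (Node C n) (Node C n) ℝ)
    (hA01 : ∀ u v, A u v = 0 ∨ A u v = 1)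
    (hAsymm : Aᵀ = A)
    (hdeg : ∀ v, 0 < deg A v)
    (Zbar : Matrix (Fin C) (Fin C) ℝ)
    (hZ : IsUnit Zbar.det)
    (hZA : (Matrix.of fun (c : Fin C) (v : Node C n) => Zbar c v.1) * Ahat A = Ymat C n) :
    (∀ (c : Fin C) (i : Fin n) (c' : Fin C), sfrac A c c' i = Zbar⁻¹ c' c) ∧ CondC A := by
  have key : ∀ (c : Fin C) (i : Fin n) (c' : Fin C), sfrac A c c' i = Zbar⁻¹ c' c := by
    intro c i c'
    have h : (Zbar *ᵥ fun c' => sfrac A c c' i) = Pi.single c 1 := by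
      ext k
      rw [← kronecker_mul_Ahat_apply, hZA]
      simp [Ymat, Pi.single_apply, eq_comm]
    have h' := congrArg (Zbar⁻¹ *ᵥ ·) h
    simp only [Matrix.mulVec_mulVec, Matrix.nonsing_inv_mul _ hZ, Matrix.one_mulVec,
      Matrix.mulVec_single_one] at h'
    exact congrFun h' c'
  exact ⟨key, fun c c' i i' => (key c i c').trans (key c i' c').symm⟩

end
end

section
/- (Expansion of H·𝔼Â·Hᵀ, Appendix D.) For every H ∈ ℝ^{d×N}: H · 𝔼Â · Hᵀ = 2n · (Σ̃_B(H) − (2q/(p+q)) · Σ_B(H)). -/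
open Matrix Finset

noncomputable section

/-- Nodes for the two-class model: class index in `Fin 2`, within-class index in `Fin n`. -/
abbrev V2 (n : ℕ) := Fin 2 × Fin n

/-- The expected normalized adjacency matrix `𝔼Â` of the two-class SSBM. -/
def EAmat (n : ℕ) (p q : ℝ) : Matrix (V2 n) (V2 n) ℝ :=
  Matrix.of fun u v => (if u.1 = v.1 then p else q) / ((n : ℝ) * (p + q))

/-- Target matrix `Y = I₂ ⊗ 1ₙᵀ`. -/
def Y2 (n : ℕ) : Matrix (Fin 2) (V2 n) ℝ :=
  Matrix.of fun c v => if v.1 = c then 1 else 0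

/-- Class mean `h̄_c` of the columns of `H` in class `c`. -/
def classMean {n d : ℕ} (H : Matrix (Fin d) (V2 n) ℝ) (c : Fin 2) : Fin d → ℝ :=
  fun r => (1 / (n : ℝ)) * ∑ j, H r (c, j)

/-- Global mean `h̄_G = (h̄₁ + h̄₂)/2`. -/
def globalMean {n d : ℕ} (H : Matrix (Fin d) (V2 n) ℝ) : Fin d → ℝ :=
  fun r => (classMean H 0 r + classMean H 1 r) / 2

/-- Between-class covariance `Σ_B(H) = ¼(h̄₁ − h̄₂)(h̄₁ − h̄₂)ᵀ`. -/
def SigmaB {n d : ℕ} (H : Matrix (Fin d) (V2 n) ℝ) : Matrix (Fin d) (Fin d) ℝ :=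
  (1 / 4 : ℝ) • vecMulVec (classMean H 0 - classMean H 1) (classMean H 0 - classMean H 1)

/-- Non-centered between-class covariance `Σ̃_B(H) = ½(h̄₁h̄₁ᵀ + h̄₂h̄₂ᵀ)`. -/
def SigmaBtilde {n d : ℕ} (H : Matrix (Fin d) (V2 n) ℝ) : Matrix (Fin d) (Fin d) ℝ :=
  (1 / 2 : ℝ) • (vecMulVec (classMean H 0) (classMean H 0)
    + vecMulVec (classMean H 1) (classMean H 1))

/-- Global-mean covariance `Σ_G(H) = h̄_G h̄_Gᵀ`. -/
def SigmaG {n d : ℕ} (H : Matrix (Fin d) (V2 n) ℝ) : Matrix (Fin d) (Fin d) ℝ :=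
  vecMulVec (globalMean H) (globalMean H)

/-- Within-class covariance `Σ_W(H)`. -/
def SigmaW {n d : ℕ} (H : Matrix (Fin d) (V2 n) ℝ) : Matrix (Fin d) (Fin d) ℝ :=
  (1 / (2 * (n : ℝ))) • ∑ c : Fin 2, ∑ j : Fin n,
    vecMulVec (fun r => H r (c, j) - classMean H c r) (fun r => H r (c, j) - classMean H c r)

/-- Pairing a row of `H` with a weight that is constant on each class only sees the class means. -/
theorem sum_mul_class_weight {n d : ℕ} (hn : n ≠ 0) (H : Matrix (Fin d) (V2 n) ℝ) (r : Fin d)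
    (w : Fin 2 → ℝ) :
    ∑ v, H r v * w v.1 = n * (classMean H 0 r * w 0 + classMean H 1 r * w 1) := by
  have hn' : (n : ℝ) ≠ 0 := Nat.cast_ne_zero.mpr hn
  have class_sum (c : Fin 2) : ∑ j, H r (c, j) * w c = n * classMean H c r * w c := by
    refine (Finset.sum_mul _ _ _).symm.trans ?_
    simp only [classMean]
    field_simp
  rw [Fintype.sum_prod_type, Fin.sum_univ_two]
  refine (congrArg₂ (· + ·) (class_sum 0) (class_sum 1)).trans ?_
  ring

/-- Expansion of `H·𝔼Â·Hᵀ` (Appendix D). -/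
theorem H_EA_Ht_expansion
    (n d : ℕ) (hn : 1 ≤ n) (p q : ℝ) (hp : 0 ≤ p) (hq : 0 ≤ q) (hpq : 0 < p + q)
    (H : Matrix (Fin d) (V2 n) ℝ) :
    H * EAmat n p q * Hᵀ =
      (2 * (n : ℝ)) • (SigmaBtilde H - (2 * q / (p + q)) • SigmaB H) := by
  have hn₀ : n ≠ 0 := by omega
  have hn' : (n : ℝ) ≠ 0 := Nat.cast_ne_zero.mpr hn₀
  have hpq' : p + q ≠ 0 := hpq.ne'
  ext r s
  have row (v : V2 n) : (H * EAmat n p q) r v =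
      (classMean H 0 r * (if 0 = v.1 then p else q)
        + classMean H 1 r * (if 1 = v.1 then p else q)) / (p + q) := by
    refine (sum_mul_class_weight hn₀ H r
      fun c => (if c = v.1 then p else q) / (n * (p + q))).trans ?_
    field_simp
  have entry : (H * EAmat n p q * Hᵀ) r s = ∑ v, H s v *
      ((classMean H 0 r * (if 0 = v.1 then p else q)
        + classMean H 1 r * (if 1 = v.1 then p else q)) / (p + q)) := by
    rw [mul_apply]
    exact Finset.sum_congr rfl fun v _ => by rw [row, transpose_apply, mul_comm]
  rw [entry]
  refine (sum_mul_class_weight hn₀ H s fun c =>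
    (classMean H 0 r * (if 0 = c then p else q)
      + classMean H 1 r * (if 1 = c then p else q)) / (p + q)).trans ?_
  simp only [SigmaB, SigmaBtilde, Matrix.smul_apply, Matrix.sub_apply, Matrix.add_apply,
    vecMulVec_apply, Pi.sub_apply, smul_eq_mul, zero_ne_one, one_ne_zero, if_true, if_false]
  field_simp
  ring

end
end

section
/- (Expansion of H·(𝔼Â)²·Hᵀ, Appendix D.) For every H ∈ ℝ^{d×N}: H · (𝔼Â)² · Hᵀ = 2n · (Σ̃_B(H) − (4pq/(p+q)²) · Σ_B(H)). -/
open Matrix Finset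

noncomputable section

/-- Entries of `H · 𝔼Â`: each column mixes the two class means with weights `p` and `q`. -/
lemma mul_EAmat_apply {n d : ℕ} (hn : n ≠ 0) (p q : ℝ) (H : Matrix (Fin d) (V2 n) ℝ)
    (r : Fin d) (v : V2 n) :
    (H * EAmat n p q) r v =
      ((if v.1 = 0 then p else q) * classMean H 0 r
        + (if v.1 = 1 then p else q) * classMean H 1 r) / (p + q) := by
  have hn' : (n : ℝ) ≠ 0 := Nat.cast_ne_zero.mpr hn
  obtain ⟨c, j⟩ := v
  fin_cases c <;>
    simp [Matrix.mul_apply, EAmat, Fintype.sum_prod_type, ← Finset.sum_mul, classMean] <;>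
    field_simp

lemma EAmat_transpose (n : ℕ) (p q : ℝ) : (EAmat n p q)ᵀ = EAmat n p q := by
  ext u v
  simp [EAmat, eq_comm]

/-- Expansion of `H·(𝔼Â)²·Hᵀ` (Appendix D). -/
theorem H_EA_sq_Ht_expansion
    (n d : ℕ) (hn : 1 ≤ n) (p q : ℝ) (hp : 0 ≤ p) (hq : 0 ≤ q) (hpq : 0 < p + q)
    (H : Matrix (Fin d) (V2 n) ℝ) :
    H * (EAmat n p q * EAmat n p q) * Hᵀ =
      (2 * (n : ℝ)) • (SigmaBtilde H - (4 * p * q / (p + q) ^ 2) • SigmaB H) := by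
  have hn' : n ≠ 0 := Nat.one_le_iff_ne_zero.mp hn
  have hsum : p + q ≠ 0 := hpq.ne'
  have hsq : H * (EAmat n p q * EAmat n p q) * Hᵀ =
      (H * EAmat n p q) * (H * EAmat n p q)ᵀ := by
    rw [Matrix.transpose_mul, EAmat_transpose]
    simp only [Matrix.mul_assoc]
  rw [hsq]
  ext r s
  rw [Matrix.mul_apply]
  simp only [Matrix.transpose_apply, mul_EAmat_apply hn', Fintype.sum_prod_type,
    Fin.sum_univ_two, Finset.sum_const, Finset.card_univ, Fintype.card_fin, nsmul_eq_mul,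
    SigmaBtilde, SigmaB, Matrix.smul_apply, Matrix.sub_apply, Matrix.add_apply,
    Matrix.vecMulVec_apply, Pi.sub_apply, smul_eq_mul, if_true, one_ne_zero, zero_ne_one,
    if_false]
  field_simp
  ring

end
end
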